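/- Let k, ℓ ≥ 3 be integers and let λ = (k, 1^{ℓ−1}) be the hook partition with first part k and ℓ−1 parts equal to 1. Then for any number of variables n ≥ ℓ, the symmetric polynomial (s_λ^{(1)})^2 − s_λ · s_λ^{(2)} in the variables x_1,…,x_n is Schur positive. -/

import Mathlib

open MvPolynomial

noncomputable section

/-- The complete homogeneous symmetric polynomial in `n` variables, indexed by an
integer (by convention it is `0` for negative indices). -/
def hInt (n : ℕ) (k : ℤ) : MvPolynomial (Fin n) ℚ :=
  if 0 ≤ k then MvPolynomial.hsymm (Fin n) ℚ k.toNat else 0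

/-- The number of (nonzero) parts of a partition `lam : ℕ → ℕ` (parts are indexed
starting from `0`). -/
def partLen (lam : ℕ → ℕ) : ℕ := sInf {N | lam N = 0}

/-- A partition, recorded as a weakly decreasing, eventually zero function `ℕ → ℕ`
listing its parts (indexed starting from `0`). -/
def IsPartition (lam : ℕ → ℕ) : Prop := Antitone lam ∧ ∃ N, ∀ i, N ≤ i → lam i = 0

/-- The Schur polynomial of a partition in `n` variables, via the Jacobi-Trudi identity
`s_lam = det (h_{lam_i + j - i})`. -/
def schur (n : ℕ) (lam : ℕ → ℕ) : MvPolynomial (Fin n) ℚ :=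
  (Matrix.of fun i j : Fin (partLen lam) =>
    hInt n ((lam i : ℤ) + ((j : ℕ) : ℤ) - ((i : ℕ) : ℤ))).det

/-- The `i`-th derived polynomial `p^{(i)}` of `p`, defined by the identity
`p (x₁ + t, …, xₙ + t) = ∑ i, t^i • p^{(i)} (x₁, …, xₙ)`: substituting `X j + t` for each
variable `X j` yields a polynomial in `t` whose `t^i`-coefficient is `p^{(i)}`. -/
def derived (n i : ℕ) (p : MvPolynomial (Fin n) ℚ) : MvPolynomial (Fin n) ℚ :=
  (MvPolynomial.aeval
    (fun j : Fin n => (Polynomial.C (X j) + Polynomial.X : Polynomial (MvPolynomial (Fin n) ℚ)))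
    p).coeff i

/-- A symmetric polynomial is Schur positive if it is a linear combination of Schur
polynomials (of partitions) with non-negative coefficients. -/
def SchurPositive (n : ℕ) (f : MvPolynomial (Fin n) ℚ) : Prop :=
  ∃ (S : Finset (ℕ → ℕ)) (c : (ℕ → ℕ) → ℚ),
    (∀ μ ∈ S, IsPartition μ) ∧ (∀ μ ∈ S, 0 ≤ c μ) ∧ f = ∑ μ ∈ S, c μ • schur n μ

section Derived

variable {n : ℕ}

/-- The derivation `∑ i, ∂/∂xᵢ`. -/
def shiftDeriv (n : ℕ) : Derivation ℚ (MvPolynomial (Fin n) ℚ) (MvPolynomial (Fin n) ℚ) :=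
  ∑ i, pderiv i

theorem shiftDeriv_apply (p : MvPolynomial (Fin n) ℚ) :
    shiftDeriv n p = ∑ i, pderiv i p := by
  exact (congrFun (map_sum (Derivation.coeFnAddMonoidHom (R := ℚ) (A := MvPolynomial (Fin n) ℚ)
    (M := MvPolynomial (Fin n) ℚ)) pderiv Finset.univ) p).trans (Finset.sum_apply _ _ _)

theorem shiftDeriv_X (j : Fin n) : shiftDeriv n (X j) = 1 := by
  simp [shiftDeriv_apply, pderiv_X, Pi.single_apply]

theorem shiftDeriv_C (a : ℚ) : shiftDeriv n (C a) = 0 := by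
  simp

theorem derived_add (i : ℕ) (p q : MvPolynomial (Fin n) ℚ) :
    derived n i (p + q) = derived n i p + derived n i q := by
  simp [derived]

theorem derived_C_succ (i : ℕ) (a : ℚ) : derived n (i + 1) (C a) = 0 := by
  simp only [derived, MvPolynomial.aeval_C]
  rw [Polynomial.algebraMap_apply]
  simp

theorem derived_zero (p : MvPolynomial (Fin n) ℚ) : derived n 0 p = p := by
  induction p using MvPolynomial.induction_on with
  | C a =>
    simp only [derived, MvPolynomial.aeval_C, Polynomial.algebraMap_apply]
    simp
  | add p q hp hq => rw [derived_add, hp, hq]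
  | mul_X p i hp =>
    simp only [derived] at hp ⊢
    simp [mul_add, hp]

theorem derived_mul_X (i : ℕ) (p : MvPolynomial (Fin n) ℚ) (j : Fin n) :
    derived n (i + 1) (p * X j) = derived n (i + 1) p * X j + derived n i p := by
  simp [derived, mul_add]

theorem derived_one (p : MvPolynomial (Fin n) ℚ) : derived n 1 p = shiftDeriv n p := by
  induction p using MvPolynomial.induction_on with
  | C a => rw [derived_C_succ, shiftDeriv_C]
  | add p q hp hq => rw [derived_add, hp, hq, map_add]
  | mul_X p i hp =>
    rw [derived_mul_X, derived_zero, hp, Derivation.leibniz, shiftDeriv_X]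
    simp only [smul_eq_mul]
    ring

theorem two_mul_derived_two (p : MvPolynomial (Fin n) ℚ) :
    2 * derived n 2 p = shiftDeriv n (shiftDeriv n p) := by
  induction p using MvPolynomial.induction_on with
  | C a => rw [derived_C_succ, shiftDeriv_C, map_zero, mul_zero]
  | add p q hp hq => rw [derived_add, mul_add, hp, hq, map_add, map_add]
  | mul_X p i hp =>
    rw [derived_mul_X, derived_one, mul_add, ← mul_assoc, hp]
    simp only [Derivation.leibniz, shiftDeriv_X, smul_eq_mul, map_add, mul_one]
    ring

theorem coeff_hsymm (k : ℕ) (m : Fin n →₀ ℕ) :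
    coeff m (hsymm (Fin n) ℚ k) = if m.degree = k then 1 else 0 := by
  have hmon (s : Sym (Fin n) k) :
      (s.1.map (X : Fin n → MvPolynomial (Fin n) ℚ)).prod =
        monomial (Multiset.toFinsupp s.1) 1 := by
    rw [monomial_eq, Finset.prod_multiset_map_count, C_1, one_mul, Finsupp.prod,
      Multiset.toFinsupp_support]
    simp
  simp only [hsymm, hmon, coeff_sum, coeff_monomial]
  have hdeg (s : Multiset (Fin n)) : (Multiset.toFinsupp s).degree = s.card := by
    simp [Finsupp.degree_eq_sum]
  split_ifs with h
  · have hc : (Finsupp.toMultiset m).card = k := by rw [← hdeg]; simpa using h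
    refine (Finset.sum_eq_single_of_mem (Sym.mk (Finsupp.toMultiset m) hc)
      (Finset.mem_univ _) ?_).trans ?_
    · intro s _ hs
      rw [if_neg]
      rintro rfl
      exact hs (Subtype.ext (by simp))
    · simp
  · refine Finset.sum_eq_zero fun s _ => if_neg ?_
    rintro rfl
    exact h ((hdeg _).trans s.2)

theorem shiftDeriv_hsymm (k : ℕ) :
    shiftDeriv n (hsymm (Fin n) ℚ (k + 1)) = (n + k : ℚ) • hsymm (Fin n) ℚ k := by
  ext m
  rw [shiftDeriv_apply, coeff_sum]
  simp only [coeff_pderiv, coeff_hsymm, coeff_smul, map_add, Finsupp.degree_single,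
    add_left_inj]
  split_ifs with h
  · simp [← h, Finset.sum_add_distrib, Finsupp.degree_eq_sum, add_comm]
  · simp

theorem shiftDeriv_hInt (k : ℤ) :
    shiftDeriv n (hInt n (k + 1)) = (n + k : ℚ) • hInt n k := by
  obtain hk | hk := lt_or_ge k 0
  · obtain hk | rfl : k + 1 < 0 ∨ k = -1 := by omega
    · simp [hInt, not_le.2 hk, show ¬ 0 ≤ k by omega]
    · simp [hInt]
  · lift k to ℕ using hk
    have := shiftDeriv_hsymm (n := n) k
    simpa [hInt, show (0 : ℤ) ≤ k + 1 by omega, show ((k : ℤ) + 1).toNat = k + 1 by omega] using this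

end Derived

section Determinants

open Matrix

variable {R : Type*} [CommRing R] (h : ℤ → R)

/-- The Jacobi-Trudi determinant of the column `(1 ^ b)`. -/
def columnDet (b : ℕ) : R :=
  (Matrix.of fun i j : Fin b => h (1 + ((j : ℕ) : ℤ) - ((i : ℕ) : ℤ))).det

/-- The Jacobi-Trudi determinant of the hook with arm length `a` and leg length `b`. -/
def hookDet (a : ℤ) (b : ℕ) : R :=
  (Matrix.of fun i j : Fin (b + 1) =>
    h ((if i = 0 then a + 1 else 1) + ((j : ℕ) : ℤ) - ((i : ℕ) : ℤ))).det

theorem hookDet_zero_right (a : ℤ) : hookDet h a 0 = h (a + 1) := by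
  simp [hookDet]

theorem hookDet_zero_left (b : ℕ) : hookDet h 0 b = columnDet h (b + 1) := by
  simp [hookDet, columnDet]

theorem columnDet_zero : columnDet h 0 = 1 := by
  simp [columnDet]

variable {h} (h0 : h 0 = 1) (hneg : ∀ k < 0, h k = 0)

include h0 hneg in
theorem hookDet_succ (a : ℤ) (b : ℕ) :
    hookDet h a (b + 1) = h (a + 1) * columnDet h (b + 1) - hookDet h (a + 1) b := by
  rw [hookDet, det_succ_column_zero, Fin.sum_univ_succ, Fin.sum_univ_succ,
    Finset.sum_eq_zero, add_zero, sub_eq_add_neg]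
  · congr 1
    · simp only [of_apply, Fin.val_zero, pow_zero, one_mul, if_true, columnDet]
      congr 2
      · simp
      · ext i j
        simp only [submatrix_apply, of_apply, Fin.succAbove_zero, Fin.succ_ne_zero, if_false,
          Fin.val_succ]
        congr 1
        push_cast
        ring
    · have h1 : (Matrix.of fun i j : Fin (b + 1 + 1) =>
          h ((if i = 0 then a + 1 else 1) + ((j : ℕ) : ℤ) - ((i : ℕ) : ℤ))) (Fin.succ 0) 0 = 1 := by
        simp [h0]
      rw [h1, hookDet]
      simp only [Fin.val_succ, Fin.val_zero, zero_add, pow_one, mul_one, neg_mul, one_mul]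
      congr 2
      ext i j
      simp only [submatrix_apply, of_apply]
      refine Fin.cases ?_ (fun i => ?_) i
      · simp only [Fin.succ_succAbove_zero, if_true, Fin.val_succ, Fin.val_zero]
        congr 1
        push_cast
        ring
      · simp only [Fin.succ_succAbove_succ, Fin.zero_succAbove, Fin.succ_ne_zero, if_false,
          Fin.val_succ]
        congr 1
        push_cast
        ring
  · intro i _
    have h1 : (Matrix.of fun i j : Fin (b + 1 + 1) =>
        h ((if i = 0 then a + 1 else 1) + ((j : ℕ) : ℤ) - ((i : ℕ) : ℤ))) i.succ.succ 0 = 0 := by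
      simp only [of_apply, Fin.succ_ne_zero, if_false, Fin.val_succ]
      apply hneg
      push_cast
      simp
      omega
    rw [h1]
    simp

include h0 hneg in
theorem hookDet_neg (s m : ℕ) :
    hookDet h (-1 - (s : ℤ)) m = if m = s then (-1) ^ s else 0 := by
  induction s generalizing m with
  | zero =>
    cases m with
    | zero => simp [hookDet_zero_right, h0]
    | succ m => simp [hookDet_succ h0 hneg, h0, hookDet_zero_left]
  | succ s ih =>
    have hs : h (-1 - ((s + 1 : ℕ) : ℤ) + 1) = 0 := hneg _ (by push_cast; omega)
    cases m with
    | zero => rw [hookDet_zero_right, hs]; simp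
    | succ m =>
      have : -1 - ((s + 1 : ℕ) : ℤ) + 1 = -1 - (s : ℤ) := by push_cast; ring
      rw [hookDet_succ h0 hneg, hs, this, ih]
      simp only [Nat.add_right_cancel_iff]
      split_ifs <;> ring

include h0 hneg in
theorem sum_mul_columnDet (a : ℤ) (m : ℕ) :
    ∑ j ∈ Finset.range (m + 1), h (a + 1 + (j : ℤ)) * ((-1) ^ (m - j) * columnDet h (m - j)) =
      (-1) ^ m * hookDet h a m := by
  induction m generalizing a with
  | zero => simp [hookDet_zero_right, columnDet_zero]
  | succ m ih =>
    have := ih (a + 1)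
    rw [Finset.sum_range_succ', hookDet_succ h0 hneg]
    simp only [Nat.add_sub_add_right]
    have e (j : ℕ) : a + 1 + ((j + 1 : ℕ) : ℤ) = a + 1 + 1 + (j : ℤ) := by push_cast; ring
    simp only [e, this]
    simp only [Nat.cast_zero, add_zero, Nat.sub_zero]
    ring

include h0 hneg in
/-- A Jacobi-Trudi determinant expressed through hooks with formal, possibly negative, arms. -/
theorem det_jacobiTrudi_eq_det_hookDet (N : ℕ) (lam : ℕ → ℤ) :
    (Matrix.of fun i j : Fin N => h (lam i + ((j : ℕ) : ℤ) - ((i : ℕ) : ℤ))).det =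
      (Matrix.of fun i j : Fin N =>
        (-1) ^ (j : ℕ) * hookDet h (lam i - ((i : ℕ) : ℤ) - 1) j).det := by
  let U : Matrix (Fin N) (Fin N) R := Matrix.of fun j m =>
    if j ≤ m then (-1) ^ ((m : ℕ) - (j : ℕ)) * columnDet h ((m : ℕ) - (j : ℕ)) else 0
  have hU : U.det = 1 := by
    rw [det_of_isUpperTriangular]
    · simp [U, columnDet_zero]
    · intro i j hij
      exact if_neg (not_le.2 hij)
  refine (((congrArg _ hU).trans (mul_one _)).symm.trans (det_mul _ U).symm).trans ?_
  congr 1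
  ext i m
  rw [of_apply, ← sum_mul_columnDet h0 hneg, mul_apply]
  simp only [U, of_apply, mul_ite, mul_zero, ← Fin.val_fin_le]
  rw [Fin.sum_univ_eq_sum_range (fun j => if j ≤ (m : ℕ) then
    h (lam i + (j : ℤ) - ((i : ℕ) : ℤ)) *
      ((-1) ^ ((m : ℕ) - j) * columnDet h ((m : ℕ) - j)) else 0), ← Finset.sum_filter]
  refine Finset.sum_congr ?_ fun j _ => ?_
  · ext j
    have := m.2
    simp only [Finset.mem_filter, Finset.mem_range]
    omega
  · congr 2
    ring

theorem det_of_last_row_single {N : ℕ} (A : Matrix (Fin (N + 1)) (Fin (N + 1)) R)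
    (p : Fin (N + 1)) (hA : ∀ j, A (Fin.last N) j = if j = p then 1 else 0) :
    A.det = (-1) ^ (N + p : ℕ) * (A.submatrix Fin.castSucc p.succAbove).det := by
  rw [det_succ_row A (Fin.last N), Finset.sum_eq_single p]
  · simp [hA]
  · intro j _ hj
    simp [hA, hj]
  · simp

/-- The determinant of a matrix with two arbitrary rows followed by all standard basis vectors
except those with indices `d` and `d + t + 1`. -/
theorem det_two_rows (d t : ℕ) (v w : ℕ → R) :
    (Matrix.of fun i j : Fin (d + t + 2) =>
      if (i : ℕ) = 0 then v j else if (i : ℕ) = 1 then w j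
      else if (i : ℕ) < d + 2 then (if (j : ℕ) + 2 = i then 1 else 0)
      else (if (j : ℕ) + 1 = i then 1 else 0)).det =
      (-1) ^ t * (v d * w (d + t + 1) - v (d + t + 1) * w d) := by
  induction t generalizing v w with
  | zero =>
    induction d generalizing v w with
    | zero => simp [det_fin_two]
    | succ d ih =>
      have hp : d < d + 1 + 0 + 1 + 1 := by omega
      rw [det_of_last_row_single (N := d + 1 + 0 + 1) _ ⟨d, hp⟩]
      · have key := ih (fun j => if j < d then v j else v (j + 1))
          (fun j => if j < d then w j else w (j + 1))
        refine (congrArg₂ (· * ·) rfl (Eq.trans (congrArg Matrix.det ?_) key)).trans ?_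
        · ext i j
          have hi := i.2
          have hj : ((Fin.succAbove ⟨d, hp⟩ j : Fin _) : ℕ) =
              if (j : ℕ) < d then (j : ℕ) else j + 1 := by
            simp only [Fin.succAbove, Fin.lt_def, Fin.val_castSucc]
            split_ifs <;> simp
          simp only [submatrix_apply, of_apply, Fin.val_castSucc, hj]
          split_ifs <;> first | rfl | contradiction | omega
        · have : (-1 : R) ^ (d + 1 + 0 + 1 + d) = 1 := Even.neg_one_pow ⟨d + 1, by omega⟩
          simp [this]
      · intro j
        simp only [of_apply, Fin.val_last, Fin.ext_iff]
        split_ifs <;> first | rfl | contradiction | omega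
  | succ t ih =>
    have hp : d + t + 1 < d + (t + 1) + 1 + 1 := by omega
    rw [det_of_last_row_single (N := d + (t + 1) + 1) _ ⟨d + t + 1, hp⟩]
    · have key := ih (fun j => if j < d + t + 1 then v j else v (j + 1))
        (fun j => if j < d + t + 1 then w j else w (j + 1))
      refine (congrArg₂ (· * ·) rfl (Eq.trans (congrArg Matrix.det ?_) key)).trans ?_
      · ext i j
        have hi := i.2
        have hj : ((Fin.succAbove ⟨d + t + 1, hp⟩ j : Fin _) : ℕ) =
            if (j : ℕ) < d + t + 1 then (j : ℕ) else j + 1 := by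
          simp only [Fin.succAbove, Fin.lt_def, Fin.val_castSucc]
          split_ifs <;> simp
        simp only [submatrix_apply, of_apply, Fin.val_castSucc, hj]
        split_ifs <;> first | rfl | contradiction | omega
      · have : (-1 : R) ^ (d + (t + 1) + 1 + (d + t + 1)) = -1 :=
          Odd.neg_one_pow ⟨d + t + 1, by omega⟩
        simp only [this, if_neg (lt_irrefl _), if_pos (show d < d + t + 1 by omega), pow_succ]
        simp only [add_assoc]
        ring
    · intro j
      simp only [of_apply, Fin.val_last, Fin.ext_iff]
      split_ifs <;> first | rfl | contradiction | omega

include h0 hneg in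
/-- The Giambelli formula for partitions with two diagonal boxes. -/
theorem giambelli_two (a c : ℤ) (d t : ℕ) (lam : ℕ → ℤ) (hl0 : lam 0 = a + 1)
    (hl1 : lam 1 = c + 2) (hl2 : ∀ i, 2 ≤ i → i < d + 2 → lam i = 2)
    (hl3 : ∀ i, d + 2 ≤ i → i < d + t + 2 → lam i = 1) :
    (Matrix.of fun i j : Fin (d + t + 2) => h (lam i + ((j : ℕ) : ℤ) - ((i : ℕ) : ℤ))).det =
      hookDet h a (d + t + 1) * hookDet h c d - hookDet h a d * hookDet h c (d + t + 1) := by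
  have key := det_two_rows d t (fun j => (-1) ^ j * hookDet h a j)
    (fun j => (-1) ^ j * hookDet h c j)
  rw [det_jacobiTrudi_eq_det_hookDet h0 hneg]
  refine (congrArg Matrix.det ?_).trans (key.trans ?_)
  · have unit (s j : ℕ) : (-1) ^ j * hookDet h (-1 - (s : ℤ)) j = if j = s then 1 else 0 := by
      rw [hookDet_neg h0 hneg]
      split_ifs with hs
      · rw [hs, ← mul_pow]
        simp
      · simp
    ext i j
    have hi := i.2
    simp only [of_apply]
    split_ifs with h1 h2 h3 h4 h5
    · rw [h1, hl0]
      simp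
    · rw [h2, hl1]
      congr 2
      push_cast
      ring
    · rw [hl2 _ (by omega) h3, show (2 : ℤ) - ((i : ℕ) : ℤ) - 1 = -1 - (((i : ℕ) - 2 : ℕ) : ℤ) by
        omega, unit, if_pos (by omega)]
    · rw [hl2 _ (by omega) h3, show (2 : ℤ) - ((i : ℕ) : ℤ) - 1 = -1 - (((i : ℕ) - 2 : ℕ) : ℤ) by
        omega, unit, if_neg (by omega)]
    · rw [hl3 _ (by omega) hi, show (1 : ℤ) - ((i : ℕ) : ℤ) - 1 = -1 - (((i : ℕ) - 1 : ℕ) : ℤ) by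
        omega, unit, if_pos (by omega)]
    · rw [hl3 _ (by omega) hi, show (1 : ℤ) - ((i : ℕ) : ℤ) - 1 = -1 - (((i : ℕ) - 1 : ℕ) : ℤ) by
        omega, unit, if_neg (by omega)]
  · have e1 : (-1 : R) ^ t * (-1) ^ d * (-1) ^ (d + t + 1) = -1 := by
      rw [← pow_add, ← pow_add]
      exact Odd.neg_one_pow ⟨d + t, by omega⟩
    linear_combination (hookDet h a d * hookDet h c (d + t + 1) -
      hookDet h a (d + t + 1) * hookDet h c d) * e1

end Determinants

section HookProducts

variable {R : Type*} [CommRing R] {C : AddSubmonoid R} {f : ℤ → ℤ → R} {h e : ℤ → R}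
  (hrel : ∀ a b, f (a - 1) b + f a (b - 1) = h a * e b - if a = 0 ∧ b = 0 then 1 else 0)
  (hleft : ∀ a b, a < 0 → f a b = 0) (hright : ∀ a b, b < 0 → f a b = 0)
  (hmem : ∀ a b, f a b ∈ C)
  (hminor : ∀ a b c d, 0 ≤ c → 0 ≤ d → c < a → d < b → f a b * f c d - f a d * f c b ∈ C)

include hrel in
/-- Two exchange steps, one for the arms and one for the legs, turn products of hooks into
`2 × 2` minors. -/
theorem exchange_eq {a b : ℤ} (c d : ℤ) (ha : 0 < a) (hb : 0 < b) :
    (f (a - 1) (b - 1) * f c d - f a (b - 1) * f (c - 1) d) -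
        (f (a - 1) b * f c (d - 1) - f a b * f (c - 1) (d - 1)) =
      (f (a - 1) b * f (c - 1) d - f (a - 1) d * f (c - 1) b) +
      (f (a - 1) (b - 1) * f c d - f (a - 1) d * f c (b - 1)) +
      (f a b * f (c - 1) (d - 1) - f a (d - 1) * f (c - 1) b) +
      (f a (b - 1) * f c (d - 1) - f a (d - 1) * f c (b - 1)) +
      if c = 0 ∧ d = 0 then f (a - 1) b + f a (b - 1) else 0 := by
  have r1 := hrel a b
  have r2 := hrel c d
  have r3 := hrel a d
  have r4 := hrel c b
  rw [if_neg (by omega), sub_zero] at r1 r3 r4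
  split_ifs at r2 ⊢ <;>
  linear_combination -(f (a - 1) b + f a (b - 1)) * r2 - h c * e d * r1 +
    (f (c - 1) b + f c (b - 1)) * r3 + h a * e d * r4

include hleft hright hminor in
theorem minor_mem {a b c d : ℤ} (hac : c ≤ a) (hbd : d ≤ b) :
    f a b * f c d - f a d * f c b ∈ C := by
  obtain rfl | hac := hac.eq_or_lt
  · rw [mul_comm, sub_self]
    exact zero_mem _
  obtain rfl | hbd := hbd.eq_or_lt
  · rw [sub_self]
    exact zero_mem _
  obtain hc | hc := lt_or_ge c 0
  · simp [hleft c _ hc]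
  obtain hd | hd := lt_or_ge d 0
  · simp [hright _ d hd]
  exact hminor a b c d hc hd hac hbd

include hrel hleft hright hmem hminor

theorem exchange_mem {a b c d : ℤ} (hac : c < a) (ha : 0 < a) (hbd : d ≤ b) (hb : 0 ≤ b) :
    f (a - 1) b * f c d - f a b * f (c - 1) d ∈ C := by
  obtain hd | hd := lt_or_ge d 0
  · simp [hright _ d hd]
  have ih := exchange_mem (b := b + 1) (d := d - 1) hac ha (by omega) (by omega)
  have key := exchange_eq hrel c d ha (show 0 < b + 1 by omega)
  rw [add_sub_cancel_right] at key
  rw [← sub_add_cancel (f (a - 1) b * f c d - f a b * f (c - 1) d)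
    (f (a - 1) (b + 1) * f c (d - 1) - f a (b + 1) * f (c - 1) (d - 1)), key]
  have minor {a b c d : ℤ} := minor_mem hleft hright hminor (a := a) (b := b) (c := c) (d := d)
  refine add_mem (add_mem (add_mem (add_mem (add_mem ?_ ?_) ?_) ?_) ?_) ih
  · exact minor (by omega) (by omega)
  · exact minor (by omega) (by omega)
  · exact minor (by omega) (by omega)
  · exact minor (by omega) (by omega)
  · split_ifs
    · exact add_mem (hmem _ _) (hmem _ _)
    · exact zero_mem _
termination_by (d + 1).toNat
decreasing_by omega

/-- A product of two nested hooks lies in the cone. -/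
theorem mul_mem_of_nested {a b c d : ℤ} (hac : c ≤ a) (ha : 0 ≤ a) (hbd : d ≤ b) (hb : 0 ≤ b) :
    f a b * f c d ∈ C := by
  obtain hc | hc := lt_or_ge c 0
  · simp [hleft c _ hc]
  have ih := mul_mem_of_nested (a := a + 1) (c := c - 1) (by omega) (by omega) hbd hb
  have key := exchange_mem hrel hleft hright hmem hminor
    (show c < a + 1 by omega) (by omega) hbd hb
  rw [add_sub_cancel_right] at key
  simpa using add_mem key ih
termination_by (c + 1).toNat
decreasing_by omega

/-- The log-concavity defect in the arm direction dominates a `2 × 2` minor. -/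
theorem sq_sub_mul_sub_minor_mem {a b : ℤ} (ha : 0 < a) (hb : 0 ≤ b) :
    f (a - 1) b ^ 2 - f a b * f (a - 2) b -
      (f a b * f (a - 1) (b - 1) - f a (b - 1) * f (a - 1) b) ∈ C := by
  have h1 := exchange_mem hrel hleft hright hmem hminor
    (show a - 1 < a by omega) ha (show b - 1 ≤ b + 1 by omega) (by omega)
  have key := exchange_eq hrel (a - 1) b ha (show 0 < b + 1 by omega)
  rw [add_sub_cancel_right, show a - 1 - 1 = a - 2 by ring] at key
  rw [show a - 1 - 1 = a - 2 by ring] at h1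
  have minor {a b c d : ℤ} := minor_mem hleft hright hminor (a := a) (b := b) (c := c) (d := d)
  have m1 := minor (show a - 2 ≤ a - 1 by omega) (show b ≤ b + 1 by omega)
  have m2 := minor (show a - 2 ≤ a by omega) (show b - 1 ≤ b + 1 by omega)
  have m3 : (if a - 1 = 0 ∧ b = 0 then f (a - 1) (b + 1) + f a b else 0) ∈ C := by
    split_ifs
    · exact add_mem (hmem _ _) (hmem _ _)
    · exact zero_mem _
  convert add_mem (add_mem (add_mem h1 m1) m2) m3 using 1
  linear_combination key

end HookProducts

section SchurCone

variable (n : ℕ)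

/-- The Schur positive polynomials, as an additive submonoid. -/
def schurCone : AddSubmonoid (MvPolynomial (Fin n) ℚ) where
  carrier := {p | SchurPositive n p}
  zero_mem' := ⟨∅, 0, by simp, by simp, by simp⟩
  add_mem' := by
    classical
    rintro _ _ ⟨S, c, hS, hc, rfl⟩ ⟨T, c', hT, hc', rfl⟩
    refine ⟨S ∪ T, fun μ => (if μ ∈ S then c μ else 0) + if μ ∈ T then c' μ else 0, ?_, ?_, ?_⟩
    · intro μ hμ
      exact (Finset.mem_union.1 hμ).elim (hS μ) (hT μ)
    · intro μ _
      refine add_nonneg ?_ ?_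
      · split_ifs with hμ
        exacts [hc μ hμ, le_rfl]
      · split_ifs with hμ
        exacts [hc' μ hμ, le_rfl]
    · simp only [add_smul, ite_smul, zero_smul, Finset.sum_add_distrib, Finset.sum_ite_mem,
        Finset.union_inter_cancel_left, Finset.union_inter_cancel_right]

variable {n}

theorem smul_mem_schurCone {r : ℚ} (hr : 0 ≤ r) {p : MvPolynomial (Fin n) ℚ}
    (hp : p ∈ schurCone n) : r • p ∈ schurCone n := by
  obtain ⟨S, c, hS, hc, rfl⟩ := hp
  exact ⟨S, fun μ => r * c μ, hS, fun μ hμ => mul_nonneg hr (hc μ hμ), by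
    simp [Finset.smul_sum, mul_smul]⟩

theorem schur_mem_schurCone {lam : ℕ → ℕ} (hlam : IsPartition lam) :
    schur n lam ∈ schurCone n :=
  ⟨{lam}, 1, by simpa using hlam, by simp, by simp⟩

theorem schur_eq_det {lam : ℕ → ℕ} {L : ℕ} (hpos : ∀ i < L, lam i ≠ 0) (hL : lam L = 0) :
    schur n lam = (Matrix.of fun i j : Fin L =>
      hInt n ((lam i : ℤ) + ((j : ℕ) : ℤ) - ((i : ℕ) : ℤ))).det := by
  have : partLen lam = L :=
    le_antisymm (Nat.sInf_le hL)
      (le_csInf ⟨L, hL⟩ fun N hN => not_lt.1 fun hlt => hpos N hlt hN)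
  subst this
  rfl

theorem isPartition_of_antitone {lam : ℕ → ℕ} {L : ℕ} (hanti : Antitone lam) (hL : lam L = 0) :
    IsPartition lam :=
  ⟨hanti, L, fun _ hi => Nat.le_zero.1 (hL ▸ hanti hi)⟩

theorem hInt_zero : hInt n 0 = 1 := by
  simp [hInt]

theorem hInt_neg (k : ℤ) (hk : k < 0) : hInt n k = 0 :=
  if_neg (not_le.2 hk)

theorem schur_hook (a b : ℕ) :
    schur n (fun i => if i = 0 then a + 1 else if i < b + 1 then 1 else 0) =
      hookDet (hInt n) a b := by
  rw [schur_eq_det (L := b + 1)]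
  · rw [hookDet]
    congr 2
    ext i j : 2
    have hi := i.2
    by_cases h0 : i = 0
    · simp [h0]
    · simp [h0, hi]
  · intro i hi
    split_ifs <;> omega
  · simp

theorem hookDet_mem_schurCone (a b : ℕ) : hookDet (hInt n) a b ∈ schurCone n := by
  rw [← schur_hook]
  refine schur_mem_schurCone (isPartition_of_antitone (L := b + 1) (fun i j hij => ?_) (by simp))
  split_ifs <;> omega

theorem minor_mem_schurCone {a c d : ℕ} (t : ℕ) (hca : c < a) :
    hookDet (hInt n) a (d + t + 1) * hookDet (hInt n) c d -
      hookDet (hInt n) a d * hookDet (hInt n) c (d + t + 1) ∈ schurCone n := by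
  let lam : ℕ → ℕ := fun i => if i = 0 then a + 1 else if i = 1 then c + 2
    else if i < d + 2 then 2 else if i < d + t + 2 then 1 else 0
  have hL : lam (d + t + 2) = 0 := by
    simp only [lam]
    split_ifs <;> omega
  have hdet : schur n lam = _ := (schur_eq_det (L := d + t + 2) (fun i hi => by
      simp only [lam]
      split_ifs <;> omega) hL).trans
    (giambelli_two hInt_zero hInt_neg a c d t (fun i => (lam i : ℤ)) (by simp [lam])
      (by simp [lam])
      (fun i h2 hi => by
        simp only [lam]
        split_ifs <;> first | rfl | omega)
      (fun i h2 hi => by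
        simp only [lam]
        split_ifs <;> first | rfl | omega))
  rw [← hdet]
  refine schur_mem_schurCone (isPartition_of_antitone (fun i j hij => ?_) hL)
  simp only [lam]
  split_ifs <;> omega

/-- The Schur polynomial of the hook with arm length `a` and leg length `b`, understood as `0` when
one of these is negative. -/
def hookSchur (n : ℕ) (a b : ℤ) : MvPolynomial (Fin n) ℚ :=
  if 0 ≤ a ∧ 0 ≤ b then hookDet (hInt n) a b.toNat else 0

/-- The Schur polynomial of a column, indexed by an integer. -/
def columnSchur (n : ℕ) (b : ℤ) : MvPolynomial (Fin n) ℚ :=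
  if 0 ≤ b then columnDet (hInt n) b.toNat else 0

theorem hookSchur_of_left_neg (a b : ℤ) (ha : a < 0) : hookSchur n a b = 0 :=
  if_neg fun h => absurd h.1 (not_le.2 ha)

theorem hookSchur_of_right_neg (a b : ℤ) (hb : b < 0) : hookSchur n a b = 0 :=
  if_neg fun h => absurd h.2 (not_le.2 hb)

theorem hookSchur_of_nonneg {a : ℤ} (ha : 0 ≤ a) (b : ℕ) :
    hookSchur n a b = hookDet (hInt n) a b := by
  simp [hookSchur, ha]

theorem hookSchur_add_hookSchur (a b : ℤ) :
    hookSchur n (a - 1) b + hookSchur n a (b - 1) =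
      hInt n a * columnSchur n b - if a = 0 ∧ b = 0 then 1 else 0 := by
  obtain hb | hb := lt_or_ge b 0
  · rw [hookSchur_of_right_neg _ _ hb, hookSchur_of_right_neg _ _ (by omega), columnSchur,
      if_neg (by omega), if_neg (by omega)]
    ring
  lift b to ℕ using hb
  have hcol : columnSchur n b = columnDet (hInt n) b := by simp [columnSchur]
  rw [hcol]
  obtain ha | rfl | ha := lt_trichotomy a 0
  · rw [hookSchur_of_left_neg _ _ ha, hookSchur_of_left_neg _ _ (by omega), hInt_neg _ ha,
      if_neg (by omega)]
    ring
  · rw [hookSchur_of_left_neg _ _ (by omega), hInt_zero]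
    cases b with
    | zero =>
      rw [hookSchur_of_right_neg _ _ (by simp), columnDet_zero]
      simp
    | succ b =>
      rw [show ((b + 1 : ℕ) : ℤ) - 1 = b by push_cast; ring, hookSchur_of_nonneg le_rfl,
        hookDet_zero_left, if_neg (by omega)]
      ring
  · rw [hookSchur_of_nonneg (by omega), if_neg (by omega)]
    cases b with
    | zero =>
      rw [hookSchur_of_right_neg _ _ (by simp), hookDet_zero_right, columnDet_zero]
      simp
    | succ b =>
      rw [show ((b + 1 : ℕ) : ℤ) - 1 = b by push_cast; ring, hookSchur_of_nonneg ha.le,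
        hookDet_succ hInt_zero hInt_neg, sub_add_cancel]
      ring

theorem hookSchur_mem_schurCone (a b : ℤ) : hookSchur n a b ∈ schurCone n := by
  rw [hookSchur]
  split_ifs with h
  · lift a to ℕ using h.1
    exact hookDet_mem_schurCone _ _
  · exact zero_mem _

theorem hookSchur_minor_mem_schurCone (a b c d : ℤ) (hc : 0 ≤ c) (hd : 0 ≤ d) (hca : c < a)
    (hdb : d < b) :
    hookSchur n a b * hookSchur n c d - hookSchur n a d * hookSchur n c b ∈ schurCone n := by
  lift c to ℕ using hc
  lift d to ℕ using hd
  lift a to ℕ using by omega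
  obtain ⟨t, rfl⟩ : ∃ t : ℕ, b = ((d + t + 1 : ℕ) : ℤ) := ⟨(b - d - 1).toNat, by omega⟩
  simp only [hookSchur_of_nonneg (Int.natCast_nonneg _)]
  exact minor_mem_schurCone t (by omega)

theorem shiftDeriv_hookSchur (a : ℤ) (b : ℕ) (ha : 0 ≤ a) (hab : 0 < a ∨ 0 < b) :
    shiftDeriv n (hookSchur n a b) =
      (n + a : ℚ) • hookSchur n (a - 1) b + (n - b : ℚ) • hookSchur n a (b - 1) := by
  have rel := hookSchur_add_hookSchur (n := n)
  have row (a : ℤ) (ha : 0 ≤ a) : hookSchur n a 0 = hInt n (a + 1) := by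
    simpa [hookDet_zero_right] using hookSchur_of_nonneg (n := n) ha 0
  have col0 : columnSchur n 0 = 1 := by simp [columnSchur, columnDet_zero]
  induction b generalizing a with
  | zero =>
    have h1 := row (a - 1) (by omega)
    rw [sub_add_cancel] at h1
    rw [Nat.cast_zero, row a ha, shiftDeriv_hInt, h1, hookSchur_of_right_neg _ _ (by omega)]
    simp
  | succ b ih =>
    have hcol : columnSchur n (b + 1) = hookSchur n 0 b := by
      have := rel 0 (b + 1)
      rw [hookSchur_of_left_neg _ _ (by omega), hInt_zero, if_neg (by omega),
        add_sub_cancel_right] at this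
      linear_combination -this
    have hDcol : shiftDeriv n (columnSchur n (b + 1)) = (n - b : ℚ) • columnSchur n b := by
      rw [hcol]
      obtain rfl | hb := Nat.eq_zero_or_pos b
      · rw [Nat.cast_zero, row 0 le_rfl, shiftDeriv_hInt, hInt_zero, col0]
        simp
      · have := rel 0 b
        rw [hookSchur_of_left_neg _ _ (by omega), hInt_zero, if_neg (by omega)] at this
        rw [ih 0 le_rfl (Or.inr hb), hookSchur_of_left_neg _ _ (by omega),
          show hookSchur n 0 (b - 1) = columnSchur n b by linear_combination this]
        simp
    have r1 := rel (a + 1) (b + 1)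
    have r2 := rel a (b + 1)
    have r3 := rel (a + 1) b
    rw [if_neg (by omega), add_sub_cancel_right, add_sub_cancel_right] at r1
    rw [if_neg (by omega), add_sub_cancel_right] at r2
    rw [if_neg (by omega), add_sub_cancel_right] at r3
    have hD := ih (a + 1) (by omega) (by omega)
    rw [add_sub_cancel_right] at hD
    push_cast
    rw [add_sub_cancel_right,
      show hookSchur n a (b + 1) = hInt n (a + 1) * columnSchur n (b + 1) -
        hookSchur n (a + 1) b by linear_combination r1, map_sub, Derivation.leibniz, hDcol,
      shiftDeriv_hInt, hD]
    simp only [smul_eq_mul, smul_eq_C_mul, map_add, map_sub, Int.cast_add, Int.cast_one, C_1]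
    linear_combination (C (n : ℚ) + C (a : ℚ)) * (-r2) - (C (n : ℚ) - C (b : ℚ)) * r3

end SchurCone

/-- A quadratic expression in a hook Schur polynomial and its neighbours, in which `S` stands for
the Schur polynomial with two diagonal boxes. -/
theorem quadratic_identity {σ : Type*} (A B : ℚ) (s p q r x y S : MvPolynomial σ ℚ)
    (hS : S = s * r - p * q) :
    (A • p + B • q) ^ 2 - s * ((1 / 2 : ℚ) •
        (A • ((A - 1) • x + B • r) + B • (A • r + (B + 1) • y))) =
      A ^ 2 • (p ^ 2 - s * x - S) + B ^ 2 • (q ^ 2 - s * y - S) + (A - B) ^ 2 • S +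
      (A * B) • (s * r) + (A * (A + 1) / 2) • (s * x) + (B * (B - 1) / 2) • (s * y) := by
  have half : (2 : MvPolynomial σ ℚ) * C (1 / 2) = 1 := by
    rw [show (2 : MvPolynomial σ ℚ) = C 2 from (map_ofNat C 2).symm, ← C_mul]
    norm_num
  simp only [smul_eq_C_mul, div_eq_mul_one_div (A * (A + 1)), div_eq_mul_one_div (B * (B - 1)),
    map_add, map_sub, map_mul, map_pow, C_1, hS]
  linear_combination (-(C A * C B * s * r) - C A ^ 2 * (s * x) - C B ^ 2 * (s * y)) * half

/-- for a hook partition `λ = (k, 1^(ℓ-1))` with `k, ℓ ≥ 3` and `n ≥ ℓ`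
variables, `(s_λ^{(1)})^2 - s_λ * s_λ^{(2)}` is Schur positive. -/
theorem hook_schur_positive (k ℓ n : ℕ) (hk : 3 ≤ k) (hℓ : 3 ≤ ℓ) (hn : ℓ ≤ n) :
    SchurPositive n
      ((derived n 1 (schur n (fun i => if i = 0 then k else if i < ℓ then 1 else 0))) ^ 2 -
        schur n (fun i => if i = 0 then k else if i < ℓ then 1 else 0) *
          derived n 2 (schur n (fun i => if i = 0 then k else if i < ℓ then 1 else 0))) := by
  obtain ⟨a, rfl⟩ : ∃ a, k = a + 1 := ⟨k - 1, by omega⟩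
  obtain ⟨b, rfl⟩ : ∃ b, ℓ = b + 1 := ⟨ℓ - 1, by omega⟩
  have hs : schur n (fun i => if i = 0 then a + 1 else if i < b + 1 then 1 else 0) =
      hookSchur n a b := by
    rw [schur_hook, hookSchur_of_nonneg (Int.natCast_nonneg a)]
  have hD2 : derived n 2 (hookSchur n a b) =
      (1 / 2 : ℚ) • shiftDeriv n (shiftDeriv n (hookSchur n a b)) := by
    rw [← two_mul_derived_two, smul_eq_C_mul, ← mul_assoc,
      show (2 : MvPolynomial (Fin n) ℚ) = C 2 from (map_ofNat C 2).symm, ← C_mul]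
    norm_num
  let A : ℚ := n + a
  let B : ℚ := n - b
  have hD1 : shiftDeriv n (hookSchur n a b) =
      A • hookSchur n (a - 1) b + B • hookSchur n a (b - 1) := by
    rw [shiftDeriv_hookSchur a b (by omega) (by omega), Int.cast_natCast]
  have hDp : shiftDeriv n (hookSchur n (a - 1) b) =
      (A - 1) • hookSchur n (a - 2) b + B • hookSchur n (a - 1) (b - 1) := by
    rw [shiftDeriv_hookSchur (a - 1) b (by omega) (by omega), Int.cast_sub, Int.cast_natCast,
      Int.cast_one, ← add_sub_assoc, sub_sub (a : ℤ), one_add_one_eq_two]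
  have hDq : shiftDeriv n (hookSchur n a (b - 1)) =
      A • hookSchur n (a - 1) (b - 1) + (B + 1) • hookSchur n a (b - 2) := by
    rw [← Nat.cast_pred (by omega), shiftDeriv_hookSchur a (b - 1) (by omega) (by omega),
      Nat.cast_pred (by omega), Nat.cast_pred (by omega), Int.cast_natCast, ← sub_add,
      sub_sub (b : ℤ), one_add_one_eq_two]
  have hA : 0 ≤ A := by positivity
  have hB : 1 ≤ B := by
    have : ((b + 1 : ℕ) : ℚ) ≤ n := by exact_mod_cast hn
    push_cast at this
    simp only [B]
    linarith
  have rel := hookSchur_add_hookSchur (n := n)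
  have hmul {a b c d : ℤ} := mul_mem_of_nested (a := a) (b := b) (c := c) (d := d) rel
    hookSchur_of_left_neg hookSchur_of_right_neg hookSchur_mem_schurCone
    hookSchur_minor_mem_schurCone
  have harm := sq_sub_mul_sub_minor_mem (a := a) (b := b) rel
    hookSchur_of_left_neg hookSchur_of_right_neg hookSchur_mem_schurCone
    hookSchur_minor_mem_schurCone (by omega) (by omega)
  have hleg := sq_sub_mul_sub_minor_mem (a := b) (b := a) (C := schurCone n)
    (f := fun x y => hookSchur n y x) (h := columnSchur n) (e := hInt n)
    (fun x y => by
      rw [add_comm, rel, mul_comm]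
      simp only [and_comm])
    (fun x y hx => hookSchur_of_right_neg y x hx) (fun x y hy => hookSchur_of_left_neg y x hy)
    (fun x y => hookSchur_mem_schurCone y x)
    (fun x y z w hz hw hzx hwy => by
      simpa only [mul_comm (hookSchur n w x)] using
        hookSchur_minor_mem_schurCone y x w z hw hz hwy hzx) (by omega) (by omega)
  have hS := hookSchur_minor_mem_schurCone (n := n) a b (a - 1) (b - 1) (by omega) (by omega)
    (by omega) (by omega)
  set S := hookSchur n a b * hookSchur n (a - 1) (b - 1) -
    hookSchur n a (b - 1) * hookSchur n (a - 1) b with hSdef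
  change _ ∈ schurCone n
  rw [hs, derived_one, hD2, hD1, map_add, Derivation.map_smul, Derivation.map_smul, hDp, hDq,
    quadratic_identity A B (hookSchur n a b) (hookSchur n (a - 1) b)
    (hookSchur n a (b - 1)) (hookSchur n (a - 1) (b - 1)) (hookSchur n (a - 2) b)
    (hookSchur n a (b - 2)) S (by rw [hSdef]; ring)]
  refine add_mem (add_mem (add_mem (add_mem (add_mem
    (smul_mem_schurCone (sq_nonneg A) harm)
    (smul_mem_schurCone (sq_nonneg B) (?_ : hookSchur n a (b - 1) ^ 2 -
      hookSchur n a b * hookSchur n a (b - 2) - S ∈ schurCone n)))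
    (smul_mem_schurCone (sq_nonneg (A - B)) hS))
    (smul_mem_schurCone (mul_nonneg hA (zero_le_one.trans hB))
      (hmul (a := a) (b := b) (c := a - 1) (d := b - 1) (by omega) (by omega) (by omega)
        (by omega))))
    (smul_mem_schurCone (r := A * (A + 1) / 2) (by positivity)
      (hmul (a := a) (b := b) (c := a - 2) (d := b) (by omega) (by omega) (by omega)
        (by omega))))
    (smul_mem_schurCone (r := B * (B - 1) / 2)
      (div_nonneg (mul_nonneg (zero_le_one.trans hB) (sub_nonneg.2 hB)) zero_le_two)
      (hmul (a := a) (b := b) (c := a) (d := b - 2) (by omega) (by omega) (by omega)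
        (by omega)))
  convert hleg using 1
  rw [hSdef]
  ring

end
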